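/- For every NPLCS N, location q and sets of locations A₁,B₁,…,Aₙ,Bₙ ⊆ Q, for each I ⊆ {1,…,n} let C_I = {z ∈ Q : there is a finite-memory scheduler W with Pr_W((z,ε) ⊨ ⋀_{i∈I} □◇Bᵢ ∧ ⋀_{i∈{1,…,n}∖I} □¬Aᵢ) = 1} and let C = ⋃_{I⊆{1,…,n}} C_I. Then C is reachable from (q,ε) if and only if there exists a finite-memory scheduler U with Pr_U((q,ε) ⊨ ⋀_{i=1}^n (□◇Aᵢ ⇒ □◇Bᵢ)) > 0. -/

import Mathlib

open scoped ENNReal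
open Classical

namespace NPLCSmodel

/-! ## Lossy channel systems -/

/-- Operations of a lossy channel system: send a message on a channel,
receive a message from a channel, or an internal action. -/
inductive LcsOp (C M : Type) : Type where
  | send : C → M → LcsOp C M
  | recv : C → M → LcsOp C M
  | internal : LcsOp C M

def LcsOp.IsRecv {C M : Type} : LcsOp C M → Prop
  | .recv _ _ => True
  | _ => False

/-- A transition rule `src --op--> dst`. -/
structure LcsRule (Q C M : Type) : Type where
  src : Q
  op : LcsOp C M
  dst : Q

/-- Channel contents: a word over `M` for each channel. -/
abbrev Chans (C M : Type) : Type := C → List M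

/-- Configurations: a location together with channel contents. -/
abbrev Conf (Q C M : Type) : Type := Q × Chans C M

/-- The empty channel contents ε. -/
def eps (C M : Type) : Chans C M := fun _ => []

variable {Q C M : Type}

/-- When is an operation possible on channel contents `w`? -/
def enabledOp : LcsOp C M → Chans C M → Prop
  | .recv c m, w => ∃ v, w c = m :: v
  | .send _ _, _ => True
  | .internal, _ => True

/-- Effect of an operation on the channel contents (for a perfect step). -/
def applyOp [DecidableEq C] : LcsOp C M → Chans C M → Chans C M
  | .send c m, w => Function.update w c (w c ++ [m])
  | .recv c _, w => Function.update w c (w c).tail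
  | .internal, w => w

/-- A rule is enabled in a configuration. -/
def LcsRule.EnabledIn (δ : LcsRule Q C M) (s : Conf Q C M) : Prop :=
  δ.src = s.1 ∧ enabledOp δ.op s.2

/-- A lossy channel system `L = (Q, C, M, Δ)` (the finiteness of the location,
channel and message types is imposed by `Fintype` assumptions at use sites):
a finite set of transition rules such that every location has at least one
outgoing rule that is not a receive. -/
structure LCS (Q C M : Type) : Type where
  rules : Set (LcsRule Q C M)
  finiteRules : rules.Finite
  noDeadlock : ∀ q : Q, ∃ δ ∈ rules, δ.src = q ∧ ¬ δ.op.IsRecv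

variable [DecidableEq C]

/-- Lossy step via rule `δ`: a perfect step followed by losing arbitrarily
many messages (`<+` is the (componentwise) subword relation). -/
def LCS.StepVia (L : LCS Q C M) (s : Conf Q C M) (δ : LcsRule Q C M)
    (t : Conf Q C M) : Prop :=
  δ ∈ L.rules ∧ δ.EnabledIn s ∧ t.1 = δ.dst ∧ ∀ c, List.Sublist (t.2 c) (applyOp δ.op s.2 c)

/-- Lossy step `s → t`. -/
def LCS.Step (L : LCS Q C M) (s t : Conf Q C M) : Prop := ∃ δ, L.StepVia s δ t

/-- Reachability `s →* t`. -/
def LCS.Reach (L : LCS Q C M) : Conf Q C M → Conf Q C M → Prop :=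
  Relation.ReflTransGen L.Step

/-- Constrained reachability `s →*_[X) t`: all configurations along the path,
except possibly the last one, have their location in `X`. -/
def LCS.ReachWithin (L : LCS Q C M) (X : Set Q) : Conf Q C M → Conf Q C M → Prop :=
  Relation.ReflTransGen (fun a b => L.Step a b ∧ a.1 ∈ X)

/-- Constrained reachability `s →*_[X] t`: all configurations along the path,
including `s` and `t`, have their location in `X`. -/
def LCS.ReachConstrained (L : LCS Q C M) (X : Set Q) (s t : Conf Q C M) : Prop :=
  L.ReachWithin X s t ∧ t.1 ∈ X

/-- `X` is safe for `A`. -/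
def LCS.IsSafeFor (L : LCS Q C M) (A X : Set Q) : Prop :=
  X ⊆ A ∧ ∀ x ∈ X, ∃ t, L.Step (x, eps C M) t ∧ t.1 ∈ X

/-- `Safe(A)`: the largest set safe for `A` (the union of all such sets). -/
def LCS.Safe (L : LCS Q C M) (A : Set Q) : Set Q := ⋃₀ {X | L.IsSafeFor A X}

/-- `X` is promising for `A`. -/
def LCS.IsPromisingFor (L : LCS Q C M) (A X : Set Q) : Prop :=
  ∀ x ∈ X, ∃ t, L.ReachWithin X (x, eps C M) t ∧ t.1 ∈ A

/-- `Prom(A)`: the largest set promising for `A` (the union of all such sets). -/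
def LCS.Prom (L : LCS Q C M) (A : Set Q) : Set Q := ⋃₀ {X | L.IsPromisingFor A X}

/-! ## NPLCS and the induced Markov decision process -/

/-- An NPLCS: an LCS together with a fault rate `τ ∈ (0,1)`. -/
structure NPLCS (Q C M : Type) : Type where
  L : LCS Q C M
  τ : ℝ
  τ_pos : 0 < τ
  τ_lt_one : τ < 1

/-- The number of embeddings of the second list as a subword of the first. -/
def countEmb [DecidableEq M] : List M → List M → ℕ
  | _, [] => 1
  | [], _ :: _ => 0
  | a :: v, b :: w => (if a = b then countEmb v w else 0) + countEmb v (b :: w)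

variable [Fintype C] [DecidableEq M]

/-- Total number of messages in the channels. -/
def chansSize (w : Chans C M) : ℕ := ∑ c, (w c).length

/-- `P_lost(v,v') = τ^(|v|-|v'|) · (1-τ)^|v'| · C(v,v')`, the probability that
channel contents `v` become `v'` through message losses. -/
noncomputable def plost (τ : ℝ) (v v' : Chans C M) : ℝ≥0∞ :=
  ENNReal.ofReal
    (τ ^ (chansSize v - chansSize v') * (1 - τ) ^ chansSize v' *
      (∏ c, countEmb (v c) (v' c) : ℕ))

/-- One-step probability `P_N(s, δ, t)` of the MDP of an NPLCS. -/
noncomputable def NPLCS.stepProb (N : NPLCS Q C M) (s : Conf Q C M)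
    (δ : LcsRule Q C M) (t : Conf Q C M) : ℝ≥0∞ :=
  if δ ∈ N.L.rules ∧ δ.EnabledIn s ∧ t.1 = δ.dst then
    plost N.τ (applyOp δ.op s.2) t.2
  else 0

/-! ## Probability measure of a countable-state Markov chain

Given one-step probabilities `k` on a state space `S`, the measure of a set of
trajectories is the Carathéodory outer measure generated by the probabilities
of cylinder sets; it agrees with the usual Markov-chain measure on all
measurable (in particular, on all ω-regular) sets of trajectories. -/

section Chain
variable {S : Type}

/-- Probability that the chain starting in `s` performs the finite sequence
of steps through the configurations listed in `l`. -/
noncomputable def chainPathProb (k : S → S → ℝ≥0∞) : S → List S → ℝ≥0∞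
  | _, [] => 1
  | s, t :: l => k s t * chainPathProb k t l

/-- The cylinder of trajectories starting with `s` followed by `l`. -/
def chainCyl (s : S) (l : List S) : Set (ℕ → S) :=
  {ω | ω 0 = s ∧ ∀ (i : ℕ) (h : i < l.length), ω (i + 1) = l.get ⟨i, h⟩}

/-- Premeasure: probability of a cylinder set, `∞` on other (nonempty) sets. -/
noncomputable def chainFun (k : S → S → ℝ≥0∞) (s : S) (A : Set (ℕ → S)) : ℝ≥0∞ :=
  if A = ∅ then 0 else ⨅ (l : List S) (_ : A = chainCyl s l), chainPathProb k s l

theorem chainFun_empty (k : S → S → ℝ≥0∞) (s : S) : chainFun k s ∅ = 0 := by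
  simp [chainFun]

/-- The probability, for the Markov chain with one-step probabilities `k`
started in `s`, of the set `E` of trajectories (paths starting in `s`). -/
noncomputable def chainPr (k : S → S → ℝ≥0∞) (s : S) (E : Set (ℕ → S)) : ℝ≥0∞ :=
  MeasureTheory.OuterMeasure.ofFunction (chainFun k s) (chainFun_empty k s)
    (E ∩ {ω | ω 0 = s})

end Chain

/-! ## Schedulers -/

/-- A (history-dependent, deterministic) scheduler: given the history
`h = s₁ → ⋯ → s_{n-1}` and the current configuration `sₙ`, it chooses a
transition rule of `N` enabled in `sₙ`. -/
structure Scheduler (N : NPLCS Q C M) : Type where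
  choose : List (Conf Q C M) → Conf Q C M → LcsRule Q C M
  choose_mem : ∀ h s, choose h s ∈ N.L.rules
  choose_enabled : ∀ h s, (choose h s).EnabledIn s

variable {N : NPLCS Q C M}

/-- The Markov chain `MC_U` induced by a scheduler: its states are finite
paths, represented as (history, current configuration). -/
noncomputable def Scheduler.kernel (U : Scheduler N) :
    List (Conf Q C M) × Conf Q C M → List (Conf Q C M) × Conf Q C M → ℝ≥0∞ :=
  fun a b =>
    if b.1 = a.1 ++ [a.2] then N.stepProb a.2 (U.choose a.1 a.2) b.2 else 0

/-- `Pr_U(s ⊨ E)`: the probability, under scheduler `U` with starting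
configuration `s`, of the set `E` of infinite paths (trajectories of
configurations). -/
noncomputable def Scheduler.Pr (U : Scheduler N) (s : Conf Q C M)
    (E : Set (ℕ → Conf Q C M)) : ℝ≥0∞ :=
  chainPr U.kernel ([], s) {ω | (fun i => (ω i).2) ∈ E}

/-- Memoryless scheduler: the decision depends only on the current
configuration. -/
def Scheduler.Memoryless (U : Scheduler N) : Prop :=
  ∀ h h' s, U.choose h s = U.choose h' s

/-- Blind scheduler: the decision depends only on the sequence of locations
that have been visited. -/
def Scheduler.Blind (U : Scheduler N) : Prop :=
  ∀ h h' s s', h.map Prod.fst = h'.map Prod.fst → s.1 = s'.1 →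
    U.choose h s = U.choose h' s'

/-- Finite-memory scheduler data: finitely many modes, a starting mode, a
decision rule and a next-mode function. -/
structure FMScheduler (N : NPLCS Q C M) : Type 1 where
  Mode : Type
  modeFin : Fintype Mode
  init : Mode
  D : Mode → Conf Q C M → LcsRule Q C M
  upd : Mode → Conf Q C M → Mode
  D_mem : ∀ u s, D u s ∈ N.L.rules
  D_enabled : ∀ u s, (D u s).EnabledIn s

/-- A scheduler is finite-memory if it is induced by finite-memory data. -/
def Scheduler.FiniteMemory (U : Scheduler N) : Prop :=
  ∃ fm : FMScheduler N, ∀ h s, U.choose h s = fm.D (h.foldl fm.upd fm.init) s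

/-- The Markov chain `MC_U` of a finite-memory scheduler: states are pairs
`s_u` of a configuration `s` and a mode `u`. -/
noncomputable def FMScheduler.kernel (fm : FMScheduler N) :
    Conf Q C M × fm.Mode → Conf Q C M × fm.Mode → ℝ≥0∞ :=
  fun a b =>
    if b.2 = fm.upd a.2 a.1 then N.stepProb a.1 (fm.D a.2 a.1) b.1 else 0

/-- Probability measure of the Markov chain `MC_U` of a finite-memory
scheduler, over trajectories of (configuration, mode) states. -/
noncomputable def FMScheduler.PrMC (fm : FMScheduler N)
    (a : Conf Q C M × fm.Mode) (E : Set (ℕ → Conf Q C M × fm.Mode)) : ℝ≥0∞ :=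
  chainPr fm.kernel a E

/-- Reachability in the Markov chain `MC_U` of a finite-memory scheduler. -/
def FMScheduler.MCReach (fm : FMScheduler N) :
    Conf Q C M × fm.Mode → Conf Q C M × fm.Mode → Prop :=
  Relation.ReflTransGen (fun a b => 0 < fm.kernel a b)

/-- The history (the first `i` configurations) of a trajectory. -/
def histTo (ω : ℕ → Conf Q C M) (i : ℕ) : List (Conf Q C M) :=
  (List.range i).map ω

/-- Almost blind scheduler: there are a scheduler `W` and a blind scheduler
`V` such that from any starting configuration, almost surely the choices of
`U` along the path agree with those of `W` up to some finite time and with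
those of `V` afterwards. -/
def Scheduler.AlmostBlind (U : Scheduler N) : Prop :=
  ∃ W V : Scheduler N, V.Blind ∧ ∀ s : Conf Q C M,
    U.Pr s {ω | ∃ n : ℕ,
      (∀ i ≤ n, U.choose (histTo ω i) (ω i) = W.choose (histTo ω i) (ω i)) ∧
      (∀ i, n < i → U.choose (histTo ω i) (ω i) = V.choose (histTo ω i) (ω i))} = 1

/-! ## LTL-style events on trajectories -/

/-- `□P` -/
def evAlways {α : Type} (P : α → Prop) : Set (ℕ → α) := {ω | ∀ i, P (ω i)}

/-- `◇P` -/
def evEventually {α : Type} (P : α → Prop) : Set (ℕ → α) := {ω | ∃ i, P (ω i)}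

/-- `□◇P` -/
def evInfOften {α : Type} (P : α → Prop) : Set (ℕ → α) :=
  {ω | ∀ n, ∃ i, n ≤ i ∧ P (ω i)}

/-- `◇□P` -/
def evEvAlways {α : Type} (P : α → Prop) : Set (ℕ → α) :=
  {ω | ∃ n, ∀ i, n ≤ i → P (ω i)}

/-- The atomic proposition "the current location belongs to `A`". -/
def inLoc (A : Set Q) : Conf Q C M → Prop := fun s => s.1 ∈ A

/-! ## The measure of a countable-state Markov chain -/

section ChainMeasure

open MeasureTheory

variable {S T : Type}

/-- Prepend a state to a trajectory. -/
def consTraj (s : S) (ω : ℕ → S) : ℕ → S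
  | 0 => s
  | i + 1 => ω i

@[simp] theorem consTraj_zero (s : S) (ω : ℕ → S) : consTraj s ω 0 = s := rfl

@[simp] theorem consTraj_succ (s : S) (ω : ℕ → S) (i : ℕ) : consTraj s ω (i + 1) = ω i := rfl

theorem measurable_consTraj [MeasurableSpace S] (s : S) : Measurable (consTraj s) := by
  refine measurable_pi_iff.2 fun i => ?_
  cases i with
  | zero => exact measurable_const
  | succ i => exact measurable_pi_apply i

theorem mem_chainCyl_nil {s : S} {ω : ℕ → S} : ω ∈ chainCyl s [] ↔ ω 0 = s := by
  simp [chainCyl]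

theorem mem_chainCyl_cons {s t : S} {l : List S} {ω : ℕ → S} :
    ω ∈ chainCyl s (t :: l) ↔ ω 0 = s ∧ (fun i => ω (i + 1)) ∈ chainCyl t l := by
  simp only [chainCyl, Set.mem_ofPred_eq]
  refine and_congr_right fun _ => ⟨fun h => ⟨h 0 (by simp), fun i hi => ?_⟩, fun h i hi => ?_⟩
  · exact h (i + 1) (by simpa using hi)
  · cases i with
    | zero => exact h.1
    | succ i => exact h.2 i (by simpa using hi)

theorem measurableSet_eval [MeasurableSpace S] [DiscreteMeasurableSpace S] (P : S → Prop) (i : ℕ) :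
    MeasurableSet {ω : ℕ → S | P (ω i)} :=
  measurable_pi_apply (X := fun _ : ℕ => S) i (MeasurableSet.of_discrete (s := {x | P x}))

theorem measurableSet_chainCyl [MeasurableSpace S] [DiscreteMeasurableSpace S] (s : S)
    (l : List S) : MeasurableSet (chainCyl s l) := by
  unfold chainCyl
  rw [Set.ofPred_and]
  refine (measurableSet_eval (· = s) 0).inter ?_
  simp only [Set.ofPred_forall]
  exact MeasurableSet.iInter fun i => MeasurableSet.iInter fun h =>
    measurableSet_eval (· = l.get ⟨i, h⟩) (i + 1)

theorem tsum_chainPathProb_append {k : S → S → ℝ≥0∞} (hk : ∀ s, ∑' t, k s t = 1) (l : List S) :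
    ∀ s, ∑' t, chainPathProb k s (l ++ [t]) = chainPathProb k s l := by
  induction l with
  | nil => intro s; simp [chainPathProb, hk]
  | cons x l ih => intro s; simp [chainPathProb, ENNReal.tsum_mul_left, ih]

theorem chainCyl_subset_iUnion (s : S) (l : List S) :
    chainCyl s l ⊆ ⋃ t, chainCyl s (l ++ [t]) := by
  rintro ω ⟨h0, h⟩
  refine Set.mem_iUnion.2 ⟨ω (l.length + 1), h0, fun i hi => ?_⟩
  rcases Nat.lt_or_ge i l.length with hl | hl
  · simpa [List.getElem_append_left hl] using h i hl
  · have : i = l.length := by simp at hi; omega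
    subst this
    simp

/-- The map `f` lumps the chain with one-step probabilities `k` to the one given by `k'`. -/
def IsLumping (k : S → S → ℝ≥0∞) (k' : T → T → ℝ≥0∞) (f : S → T) : Prop :=
  ∀ s y, ∑' t, (if f t = y then k s t else 0) = k' (f s) y

theorem IsLumping.tsum_eq_one {k : S → S → ℝ≥0∞} {k' : T → T → ℝ≥0∞} {f : S → T}
    (hf : IsLumping k k' f) (hk' : ∀ s, ∑' t, k' s t = 1) (s : S) : ∑' t, k s t = 1 := by
  rw [← hk' (f s), ← tsum_congr (hf s), ENNReal.tsum_comm]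
  refine tsum_congr fun t => ?_
  rw [tsum_eq_single (f t)]
  · simp
  · intro y hy
    rw [if_neg hy.symm]

section Caratheodory

variable (k : S → S → ℝ≥0∞) (s : S)

/-- The outer measure generated by the cylinder probabilities. -/
noncomputable def chainOuter : OuterMeasure (ℕ → S) :=
  OuterMeasure.ofFunction (chainFun k s) (chainFun_empty k s)

theorem chainFun_chainCyl_le (l : List S) : chainFun k s (chainCyl s l) ≤ chainPathProb k s l := by
  unfold chainFun
  split_ifs
  · exact zero_le
  · exact iInf₂_le (f := fun l' (_ : chainCyl s l = chainCyl s l') => chainPathProb k s l') l rfl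

theorem chainOuter_chainCyl_le (l : List S) :
    chainOuter k s (chainCyl s l) ≤ chainPathProb k s l :=
  (OuterMeasure.ofFunction_le _).trans (chainFun_chainCyl_le k s l)

theorem le_chainOuter {ν : OuterMeasure (ℕ → S)}
    (h : ∀ l, ν (chainCyl s l) ≤ chainPathProb k s l) : ν ≤ chainOuter k s := by
  refine OuterMeasure.le_ofFunction.2 fun E => ?_
  unfold chainFun
  split_ifs with hE
  · simp [hE]
  · refine le_iInf₂ fun l hl => ?_
    rw [hl]
    exact h l

variable {k} in
theorem isCaratheodory_eval [Countable S] (hk : ∀ s, ∑' t, k s t = 1) (n : ℕ) (A : Set S) :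
    (chainOuter k s).IsCaratheodory {ω | ω n ∈ A} := by
  set Z : Set (ℕ → S) := {ω | ω n ∈ A}
  set ν : OuterMeasure (ℕ → S) :=
    OuterMeasure.restrict Z (chainOuter k s) + OuterMeasure.restrict Zᶜ (chainOuter k s)
  have hν : ∀ E, ν E = chainOuter k s (E ∩ Z) + chainOuter k s (E \ Z) := by
    intro E
    simp [ν, Set.sdiff_eq]
  suffices h : ν ≤ chainOuter k s by
    refine (OuterMeasure.isCaratheodory_iff_le _).2 fun E => ?_
    rw [← hν]
    exact h E
  have key : ∀ j (l : List S), n ≤ l.length + j → ν (chainCyl s l) ≤ chainPathProb k s l := by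
    intro j
    induction j with
    | zero =>
      intro l hl
      have hconst : ∃ x, ∀ ω ∈ chainCyl s l, ω n = x := by
        cases n with
        | zero => exact ⟨s, fun ω h => h.1⟩
        | succ n => exact ⟨_, fun ω h => h.2 n (by omega)⟩
      obtain ⟨x, hx⟩ := hconst
      rw [hν]
      by_cases hA : x ∈ A
      · have : chainCyl s l \ Z = ∅ := by
          rw [Set.sdiff_eq_empty]
          intro ω h
          simpa [Z, hx ω h] using hA
        rw [this, measure_empty, add_zero]
        exact (measure_mono Set.inter_subset_left).trans (chainOuter_chainCyl_le k s l)
      · have : chainCyl s l ∩ Z = ∅ := by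
          ext ω
          simp only [Set.mem_inter_iff, Set.mem_empty_iff_false, iff_false, not_and]
          intro h
          simpa [Z, hx ω h] using hA
        rw [this, measure_empty, zero_add]
        exact (measure_mono Set.sdiff_subset).trans (chainOuter_chainCyl_le k s l)
    | succ j ih =>
      intro l hl
      calc ν (chainCyl s l) ≤ ν (⋃ t, chainCyl s (l ++ [t])) :=
            measure_mono (chainCyl_subset_iUnion s l)
        _ ≤ ∑' t, ν (chainCyl s (l ++ [t])) := measure_iUnion_le _
        _ ≤ ∑' t, chainPathProb k s (l ++ [t]) :=
            ENNReal.tsum_le_tsum fun t => ih _ (by simp; omega)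
        _ = chainPathProb k s l := tsum_chainPathProb_append hk l s
  exact le_chainOuter k s fun l => key n l (by omega)

variable {k} in
/-- Any probability measure with the right cylinder probabilities computes `chainPr`. -/
theorem chainPr_eq_of_chainCyl [Countable S] [MeasurableSpace S] [DiscreteMeasurableSpace S]
    (hk : ∀ s, ∑' t, k s t = 1) (ν : Measure (ℕ → S))
    (hν : ∀ l, ν (chainCyl s l) = chainPathProb k s l)
    (hν1 : ν Set.univ = 1) {E : Set (ℕ → S)} (hE : MeasurableSet E) : chainPr k s E = ν E := by
  have hle : ∀ A, ν A ≤ chainOuter k s A :=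
    le_chainOuter (ν := ν.toOuterMeasure) k s fun l => (hν l).le
  have : IsProbabilityMeasure ν := ⟨hν1⟩
  have hZ : ν {ω | ω 0 = s} = 1 := by
    have := hν []
    simpa [chainCyl, chainPathProb] using this
  have hZ' : ν {ω | ω 0 = s}ᶜ = 0 := (prob_compl_eq_zero_iff (measurableSet_eval (· = s) 0)).2 hZ
  have hcara : (chainOuter k s).IsCaratheodory E := by
    have : (MeasurableSpace.pi : MeasurableSpace (ℕ → S)) ≤ (chainOuter k s).caratheodory := by
      refine iSup_le fun n => ?_
      rintro _ ⟨A, -, rfl⟩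
      exact isCaratheodory_eval s hk n A
    exact this E hE
  have hsum := hcara {ω | ω 0 = s}
  have h1 : chainOuter k s {ω | ω 0 = s} ≤ 1 := by
    have := chainOuter_chainCyl_le k s []
    simpa [chainCyl, chainPathProb] using this
  have hEle : ν E ≤ chainOuter k s (E ∩ {ω | ω 0 = s}) := by
    rw [← measure_inter_add_sdiff E (measurableSet_eval (· = s) 0)]
    rw [measure_mono_null (fun ω h => h.2 : E \ {ω | ω 0 = s} ⊆ {ω | ω 0 = s}ᶜ) hZ', add_zero]
    exact hle _
  have hEc : ν Eᶜ ≤ chainOuter k s ({ω | ω 0 = s} \ E) := by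
    rw [← measure_inter_add_sdiff Eᶜ (measurableSet_eval (· = s) 0)]
    rw [measure_mono_null (fun ω h => h.2 : Eᶜ \ {ω | ω 0 = s} ⊆ {ω | ω 0 = s}ᶜ) hZ', add_zero]
    refine (hle _).trans (measure_mono ?_)
    rintro ω ⟨h, h'⟩
    exact ⟨h', h⟩
  refine le_antisymm ?_ hEle
  change chainOuter k s (E ∩ {ω | ω 0 = s}) ≤ ν E
  rw [Set.inter_comm]
  have h2 : chainOuter k s ({ω | ω 0 = s} ∩ E) + ν Eᶜ ≤ ν E + ν Eᶜ := by
    rw [prob_add_prob_compl hE]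
    calc _ ≤ _ := add_le_add_right hEc _
      _ ≤ 1 := by rw [← hsum]; exact h1
  exact (ENNReal.add_le_add_iff_right (measure_ne_top _ _)).1 h2

end Caratheodory

theorem chainPathProb_eq_prod (k : S → S → ℝ≥0∞) (d : S) (l : List S) : ∀ s,
    chainPathProb k s l =
      ∏ i ∈ Finset.range l.length, k ((s :: l).getD i d) ((s :: l).getD (i + 1) d) := by
  induction l with
  | nil => intro s; simp [chainPathProb]
  | cons x l ih =>
    intro s
    rw [chainPathProb, ih, List.length_cons, Finset.prod_range_succ', mul_comm]
    simp

theorem measurable_comp_traj [MeasurableSpace S] [DiscreteMeasurableSpace S]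
    [MeasurableSpace T] (f : S → T) : Measurable fun ω : ℕ → S => fun i => f (ω i) :=
  measurable_pi_iff.2 fun i => (Measurable.of_discrete (f := f)).comp (measurable_pi_apply i)

variable [Countable S] [MeasurableSpace S] [DiscreteMeasurableSpace S]
  [Countable T] [MeasurableSpace T] [DiscreteMeasurableSpace T]

/-- The trajectory driven by a family of successor choices, one for each time and state. -/
def drivenTraj (s : S) (ξ : ℕ × S → S) : ℕ → S
  | 0 => s
  | n + 1 => ξ (n, drivenTraj s ξ n)

theorem measurable_drivenTraj (s : S) : Measurable (drivenTraj s) := by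
  refine measurable_pi_iff.2 fun n => ?_
  induction n with
  | zero => exact measurable_const
  | succ n ih =>
    have h : Measurable fun p : (ℕ × S → S) × S => p.1 (n, p.2) :=
      measurable_from_prod_countable_left fun x => measurable_pi_apply (n, x)
    exact h.comp (measurable_id.prodMk ih)

/-- The law of the successor of a state. -/
noncomputable def stepLaw {k : S → S → ℝ≥0∞} (hk : ∀ s, ∑' t, k s t = 1) (s : S) : PMF S :=
  ⟨k s, hk s ▸ ENNReal.summable.hasSum⟩

/-- The law of the Markov chain with one-step probabilities `k` started in `s`. -/
noncomputable def chainMeas {k : S → S → ℝ≥0∞} (hk : ∀ s, ∑' t, k s t = 1) (s : S) :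
    Measure (ℕ → S) :=
  (Measure.infinitePi fun p : ℕ × S => (stepLaw hk p.2).toMeasure).map (drivenTraj s)

instance {k : S → S → ℝ≥0∞} (hk : ∀ s, ∑' t, k s t = 1) (s : S) :
    IsProbabilityMeasure (chainMeas hk s) :=
  Measure.isProbabilityMeasure_map (measurable_drivenTraj s).aemeasurable

variable {k : S → S → ℝ≥0∞} (hk : ∀ s, ∑' t, k s t = 1)

theorem chainMeas_chainCyl (s : S) (l : List S) :
    chainMeas hk s (chainCyl s l) = chainPathProb k s l := by
  set σ : ℕ → S := fun i => (s :: l).getD i s with hσ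
  have hpre : drivenTraj s ⁻¹' chainCyl s l =
      Set.pi ((Finset.range l.length).image fun i => (i, σ i) : Finset (ℕ × S))
        fun p => {σ (p.1 + 1)} := by
    ext ξ
    have hcyl : drivenTraj s ξ ∈ chainCyl s l ↔
        ∀ i, i < l.length → drivenTraj s ξ (i + 1) = σ (i + 1) := by
      simp only [chainCyl, Set.mem_ofPred_eq, hσ, drivenTraj, true_and]
      refine forall₂_congr fun i hi => ?_
      simp [hi]
    rw [Set.mem_preimage, hcyl]
    simp only [Set.mem_pi, Finset.coe_image, Set.mem_image, Finset.coe_range, Set.mem_Iio,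
      Set.mem_singleton_iff, forall_exists_index, and_imp, forall_apply_eq_imp_iff₂]
    constructor
    · intro h i hi
      have hi' : drivenTraj s ξ i = σ i := by
        cases i with
        | zero => simp [drivenTraj, hσ]
        | succ i => exact h i (by omega)
      rw [← h i hi, drivenTraj, hi']
    · intro h i
      induction i with
      | zero =>
        intro hi
        have := h 0 hi
        simpa [drivenTraj, hσ] using this
      | succ i ih =>
        intro hi
        rw [drivenTraj, ih (by omega)]
        exact h (i + 1) hi
  rw [chainMeas, Measure.map_apply (measurable_drivenTraj s) (measurableSet_chainCyl s l), hpre,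
    Measure.infinitePi_pi _ (fun i _ => MeasurableSet.of_discrete),
    Finset.prod_image (by intro i _ j _ h; exact (Prod.mk.inj h).1),
    chainPathProb_eq_prod k s]
  refine Finset.prod_congr rfl fun i _ => ?_
  rw [PMF.toMeasure_apply_singleton _ _ (measurableSet_singleton _)]
  rfl

theorem chainPr_eq_chainMeas (s : S) {E : Set (ℕ → S)} (hE : MeasurableSet E) :
    chainPr k s E = chainMeas hk s E :=
  chainPr_eq_of_chainCyl s hk _ (chainMeas_chainCyl hk s) measure_univ hE

theorem chainMeas_start (s : S) : ∀ᵐ ω ∂chainMeas hk s, ω 0 = s := by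
  have := chainMeas_chainCyl hk s []
  rw [ae_iff, ← Set.compl_ofPred, prob_compl_eq_zero_iff (measurableSet_eval (· = s) 0)]
  simpa [chainCyl, chainPathProb] using this

theorem chainMeas_eq_zero {s : S} {A : Set (ℕ → S)} (h : ∀ ω ∈ A, ω 0 ≠ s) :
    chainMeas hk s A = 0 :=
  measure_mono_null h (ae_iff.1 (chainMeas_start hk s))

/-- Decomposition of the law of the chain along its first step. -/
theorem chainMeas_step (s : S) {E : Set (ℕ → S)} (hE : MeasurableSet E) :
    chainMeas hk s E = ∑' t, k s t * chainMeas hk t (consTraj s ⁻¹' E) := by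
  set ν : Measure (ℕ → S) := Measure.sum fun t => k s t • (chainMeas hk t).map (consTraj s)
  have hν : ∀ {A : Set (ℕ → S)}, MeasurableSet A →
      ν A = ∑' t, k s t * chainMeas hk t (consTraj s ⁻¹' A) := by
    intro A hA
    simp only [ν, Measure.sum_apply _ hA, Measure.smul_apply, smul_eq_mul,
      Measure.map_apply (measurable_consTraj s) hA]
  rw [← hν hE, ← chainPr_eq_chainMeas hk s hE]
  refine chainPr_eq_of_chainCyl s hk ν (fun l => ?_) ?_ hE
  · rw [hν (measurableSet_chainCyl s l)]
    cases l with
    | nil =>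
      have : consTraj s ⁻¹' chainCyl s [] = Set.univ := by
        ext ω; simp [mem_chainCyl_nil]
      simp [this, chainPathProb, hk]
    | cons x l =>
      have : consTraj s ⁻¹' chainCyl s (x :: l) = chainCyl x l := by
        ext ω; simp [mem_chainCyl_cons]
      rw [this, tsum_eq_single x, chainMeas_chainCyl, chainPathProb]
      intro y hy
      rw [chainMeas_eq_zero hk fun ω hω h => hy (h.symm.trans hω.1), mul_zero]
  · rw [hν MeasurableSet.univ]
    simp [hk]

/-- A function of the chain that is compatible with the one-step probabilities is a chain. -/
theorem chainPr_lump {k' : T → T → ℝ≥0∞} (hk' : ∀ s, ∑' t, k' s t = 1) {f : S → T}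
    (hf : IsLumping k k' f) (s : S)
    {E : Set (ℕ → T)} (hE : MeasurableSet E) :
    chainPr k' (f s) E = chainMeas hk s {ω | (fun i => f (ω i)) ∈ E} := by
  have hm := measurable_comp_traj f
  rw [chainPr_eq_of_chainCyl (f s) hk' ((chainMeas hk s).map fun ω i => f (ω i)) ?_ ?_ hE,
    Measure.map_apply hm hE]
  · rfl
  · intro l
    rw [Measure.map_apply hm (measurableSet_chainCyl _ _)]
    induction l generalizing s with
    | nil =>
      rw [chainPathProb, ← prob_compl_eq_zero_iff (hm (measurableSet_chainCyl _ _))]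
      refine chainMeas_eq_zero hk fun ω hω h => hω ?_
      simp [mem_chainCyl_nil, h]
    | cons y l ih =>
      rw [chainMeas_step hk s (hm (measurableSet_chainCyl _ _)), chainPathProb, ← hf,
        ← ENNReal.tsum_mul_right]
      refine tsum_congr fun t => ?_
      have : consTraj s ⁻¹' ((fun ω i => f (ω i)) ⁻¹' chainCyl (f s) (y :: l)) =
          (fun ω i => f (ω i)) ⁻¹' chainCyl y l := by
        ext ω
        simp [mem_chainCyl_cons]
      rw [this]
      split_ifs with hy
      · rw [← hy, ih t]
      · rw [zero_mul]
        refine mul_eq_zero_of_right _ (chainMeas_eq_zero hk fun ω hω h => hy ?_)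
        rw [← hω.1, ← h]
  · rw [Measure.map_apply hm MeasurableSet.univ]
    simp

end ChainMeasure

/-! ## Recurrence in countable-state Markov chains -/

section Recurrence

open MeasureTheory

variable {S : Type}

/-- Reachability in the graph of a Markov chain. -/
def chainReach (k : S → S → ℝ≥0∞) : S → S → Prop := Relation.ReflTransGen fun a b => 0 < k a b

/-- The trajectories that follow the transitions of the chain, visit some state of `F` infinitely
often, and visit infinitely often every state reachable from such a state. -/
structure TypicalTraj (k : S → S → ℝ≥0∞) (F : Set S) (s : S) (ω : ℕ → S) : Prop where
  start : ω 0 = s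
  step : ∀ i, 0 < k (ω i) (ω (i + 1))
  recur : ∃ a ∈ F, ω ∈ evInfOften (· = a)
  closed : ∀ a b, chainReach k a b → ω ∈ evInfOften (· = a) → ω ∈ evInfOften (· = b)

theorem TypicalTraj.reach {k : S → S → ℝ≥0∞} {F : Set S} {s : S} {ω : ℕ → S}
    (h : TypicalTraj k F s ω) {i j : ℕ}
    (hij : i ≤ j) : chainReach k (ω i) (ω j) := by
  induction j, hij using Nat.le_induction with
  | base => exact Relation.ReflTransGen.refl
  | succ j _ ih => exact ih.tail (h.step j)

theorem exists_infOften_eq {F : Set S} (hF : F.Finite) {ω : ℕ → S}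
    (h : ω ∈ evInfOften (· ∈ F)) : ∃ a ∈ F, ω ∈ evInfOften (· = a) := by
  by_contra! hcon
  have : ∀ a ∈ F, ∀ᶠ i in Filter.atTop, ω i ≠ a := by
    intro a ha
    have := hcon a ha
    simpa [evInfOften, Filter.eventually_atTop] using this
  obtain ⟨n, hn⟩ := Filter.eventually_atTop.1 ((Filter.eventually_all_finite hF).2 this)
  obtain ⟨i, hi, hiF⟩ := h n
  exact hn i hi _ hiF rfl

theorem tsum_off_le {f : S → ℝ≥0∞} (hf : ∑' t, f t = 1) {p : ℝ≥0∞} {t₀ : S} (hp : p ≤ f t₀) :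
    ∑' t, (if t = t₀ then 0 else f t) ≤ 1 - p := by
  have hsum : f t₀ + ∑' t, (if t = t₀ then 0 else f t) = 1 := by
    rw [← ENNReal.tsum_eq_add_tsum_ite t₀, hf]
  have hp1 : p ≤ 1 := hp.trans ((ENNReal.le_tsum t₀).trans hf.le)
  refine ENNReal.le_sub_of_add_le_left (ne_top_of_le_ne_top ENNReal.one_ne_top hp1) ?_
  refine le_trans ?_ hsum.le
  gcongr

variable [MeasurableSpace S] [DiscreteMeasurableSpace S]

theorem measurableSet_evInfOften (P : S → Prop) : MeasurableSet (evInfOften P) := by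
  simp only [evInfOften, Set.ofPred_forall, Set.ofPred_exists, Set.ofPred_and]
  exact MeasurableSet.iInter fun n => MeasurableSet.iUnion fun i =>
    (MeasurableSet.const _).inter (measurableSet_eval P i)

theorem measurableSet_evAlways (P : S → Prop) : MeasurableSet (evAlways P) := by
  simp only [evAlways, Set.ofPred_forall]
  exact MeasurableSet.iInter fun n => measurableSet_eval P n

variable [Countable S] {k : S → S → ℝ≥0∞} (hk : ∀ s, ∑' t, k s t = 1)

theorem chainMeas_eq_zero_of_shift {A : ℕ → Set (ℕ → S)} (hA : ∀ n, MeasurableSet (A n))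
    (h0 : ∀ s, chainMeas hk s (A 0) = 0) (hs : ∀ n s, consTraj s ⁻¹' A (n + 1) ⊆ A n) :
    ∀ n s, chainMeas hk s (A n) = 0 := by
  intro n
  induction n with
  | zero => exact h0
  | succ n ih =>
    intro s
    rw [chainMeas_step hk s (hA _), ENNReal.tsum_eq_zero]
    intro t
    rw [measure_mono_null (hs n s) (ih t), mul_zero]

theorem ae_step_pos (s : S) : ∀ᵐ ω ∂chainMeas hk s, ∀ i, 0 < k (ω i) (ω (i + 1)) := by
  rw [ae_all_iff]
  intro i
  have hmeas : ∀ n, MeasurableSet {ω : ℕ → S | k (ω n) (ω (n + 1)) = 0} := fun n => by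
    have : Measurable fun ω : ℕ → S => (ω n, ω (n + 1)) :=
      (measurable_pi_apply n).prodMk (measurable_pi_apply (n + 1))
    exact this (MeasurableSet.of_discrete (s := {p : S × S | k p.1 p.2 = 0}))
  have := chainMeas_eq_zero_of_shift hk (A := fun n => {ω | k (ω n) (ω (n + 1)) = 0}) hmeas
    (fun s => ?_) (fun n s ω h => h) i s
  · rw [ae_iff]
    simpa using this
  · rw [chainMeas_step hk s (hmeas 0), ENNReal.tsum_eq_zero]
    intro t
    by_cases ht : k s t = 0
    · rw [ht, zero_mul]
    · refine mul_eq_zero_of_right _ (chainMeas_eq_zero hk fun ω hω h => ht ?_)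
      rw [← h]
      exact hω

/-- If a set of states is reached almost surely from everywhere, it is almost surely visited
infinitely often. -/
theorem ae_infOften_of_hit {G : Set S} (h : ∀ s, chainMeas hk s (evAlways (· ∉ G)) = 0) (s : S) :
    ∀ᵐ ω ∂chainMeas hk s, ω ∈ evInfOften (· ∈ G) := by
  have := chainMeas_eq_zero_of_shift hk (A := fun n => {ω | ∀ i, n ≤ i → ω i ∉ G})
    (fun n => ?_) (fun s => ?_) (fun n s ω hω i hi => ?_)
  · have hall : ∀ᵐ ω ∂chainMeas hk s, ∀ n, ¬ ∀ i, n ≤ i → ω i ∉ G := by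
      rw [ae_all_iff]
      intro n
      rw [ae_iff]
      simpa using this n s
    filter_upwards [hall] with ω hω n
    simpa using hω n
  · simp only [Set.ofPred_forall]
    exact MeasurableSet.iInter fun i => MeasurableSet.iInter fun _ =>
      measurableSet_eval (· ∉ G) i
  · simpa [evAlways] using h s
  · exact hω (i + 1) (by omega)

/-- A geometric drift condition outside `G` forces the chain to reach `G`. -/
theorem chainMeas_avoid_eq_zero {G : Set S} {V : S → ℝ≥0∞} {β : ℝ≥0∞} (hβ : β < 1)
    (hV : ∀ s, V s ≠ ∞) (hV1 : ∀ s ∉ G, 1 ≤ V s)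
    (hdrift : ∀ s ∉ G, ∑' t, k s t * V t ≤ β * V s) (s : S) :
    chainMeas hk s (evAlways (· ∉ G)) = 0 := by
  have hmeas : ∀ n, MeasurableSet {ω : ℕ → S | ∀ i, i ≤ n → ω i ∉ G} := fun n => by
    simp only [Set.ofPred_forall]
    exact MeasurableSet.iInter fun i => MeasurableSet.iInter fun _ =>
      measurableSet_eval (· ∉ G) i
  have hin : ∀ n, ∀ s ∈ G, chainMeas hk s {ω | ∀ i, i ≤ n → ω i ∉ G} = 0 := fun n s hs =>
    chainMeas_eq_zero hk fun ω hω h => hω 0 (Nat.zero_le _) (h ▸ hs)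
  have hbound : ∀ n s, chainMeas hk s {ω | ∀ i, i ≤ n → ω i ∉ G} ≤ β ^ n * V s := by
    intro n
    induction n with
    | zero =>
      intro s
      by_cases hs : s ∈ G
      · rw [hin _ s hs]; exact zero_le
      · rw [pow_zero, one_mul]
        exact prob_le_one.trans (hV1 s hs)
    | succ n ih =>
      intro s
      by_cases hs : s ∈ G
      · rw [hin _ s hs]; exact zero_le
      · rw [chainMeas_step hk s (hmeas _)]
        calc _ ≤ ∑' t, k s t * (β ^ n * V t) := by
              refine ENNReal.tsum_le_tsum fun t => mul_le_mul_right ?_ _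
              refine (measure_mono fun ω hω i hi => ?_).trans (ih t)
              exact hω (i + 1) (by omega)
          _ = β ^ n * ∑' t, k s t * V t := by
              rw [← ENNReal.tsum_mul_left]
              exact tsum_congr fun t => by ring
          _ ≤ β ^ n * (β * V s) := mul_le_mul_right (hdrift s hs) _
          _ = β ^ (n + 1) * V s := by ring
  have hlim : Filter.Tendsto (fun n => β ^ n * V s) Filter.atTop (nhds 0) := by
    have := ENNReal.Tendsto.mul_const (ENNReal.tendsto_pow_atTop_nhds_zero_of_lt_one hβ)
      (Or.inr (hV s))
    simpa using this
  refine le_antisymm (ge_of_tendsto' hlim fun n => ?_) zero_le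
  refine le_trans (measure_mono ?_) (hbound n s)
  exact fun ω (hω : ∀ i, ω i ∉ G) i _ => hω i

/-- If every state of `G` moves to `H` with probability bounded below, then almost surely
visiting `G` infinitely often implies visiting `H` infinitely often. -/
theorem ae_infOften_imp {G H : Set S} {p : ℝ≥0∞} (hp : p ≠ 0)
    (hGH : ∀ s ∈ G, ∃ t ∈ H, p ≤ k s t) (s : S) :
    ∀ᵐ ω ∂chainMeas hk s, ω ∈ evInfOften (· ∈ G) → ω ∈ evInfOften (· ∈ H) := by
  set N : Set (ℕ → S) := evInfOften (· ∈ G) ∩ evAlways (· ∉ H) with hN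
  have hNm : MeasurableSet N := (measurableSet_evInfOften _).inter (measurableSet_evAlways _)
  have hcons : ∀ s, consTraj s ⁻¹' N ⊆ N := by
    rintro s ω ⟨h1, h2⟩
    refine ⟨fun n => ?_, fun i => h2 (i + 1)⟩
    obtain ⟨i, hi, hG⟩ := h1 (n + 1)
    obtain ⟨i, rfl⟩ : ∃ j, i = j + 1 := ⟨i - 1, by omega⟩
    exact ⟨i, by omega, hG⟩
  set m : ℝ≥0∞ := ⨆ s, chainMeas hk s N with hm
  have hm1 : m ≤ 1 := iSup_le fun s => prob_le_one
  have hle : ∀ s, chainMeas hk s N ≤ m := fun s => le_iSup (fun s => chainMeas hk s N) s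
  have hG : ∀ s ∈ G, chainMeas hk s N ≤ (1 - p) * m := by
    intro s hs
    obtain ⟨t₀, ht₀, hpt⟩ := hGH s hs
    rw [chainMeas_step hk s hNm]
    calc _ ≤ ∑' t, (if t = t₀ then 0 else k s t) * m := by
          refine ENNReal.tsum_le_tsum fun t => ?_
          split_ifs with ht
          · rw [zero_mul, ht]
            refine (mul_eq_zero_of_right _ (chainMeas_eq_zero hk fun ω hω h => ?_)).le
            have h1 : ω 0 ∉ H := hω.2 1
            exact h1 (h ▸ ht₀)
          · exact mul_le_mul_right ((measure_mono (hcons s)).trans (hle t)) _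
      _ = (∑' t, (if t = t₀ then 0 else k s t)) * m := ENNReal.tsum_mul_right
      _ ≤ (1 - p) * m := by
          exact mul_le_mul_left (tsum_off_le (hk s) hpt) _
  have hDm : ∀ n, MeasurableSet (N ∩ {ω | ∃ i, i < n ∧ ω i ∈ G}) := fun n => by
    refine hNm.inter ?_
    simp only [Set.ofPred_exists, Set.ofPred_and]
    exact MeasurableSet.iUnion fun i => (MeasurableSet.const _).inter (measurableSet_eval _ i)
  have hD : ∀ n s, chainMeas hk s (N ∩ {ω | ∃ i, i < n ∧ ω i ∈ G}) ≤ (1 - p) * m := by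
    intro n
    induction n with
    | zero => intro s; simp
    | succ n ih =>
      intro s
      by_cases hs : s ∈ G
      · exact (measure_mono Set.inter_subset_left).trans (hG s hs)
      · rw [chainMeas_step hk s (hDm _)]
        calc _ ≤ ∑' t, k s t * ((1 - p) * m) := by
              refine ENNReal.tsum_le_tsum fun t => mul_le_mul_right ?_ _
              refine (measure_mono ?_).trans (ih t)
              rintro ω ⟨h1, i, hi, hiG⟩
              refine ⟨hcons s h1, ?_⟩
              cases i with
              | zero => exact absurd hiG hs
              | succ i => exact ⟨i, by omega, hiG⟩
          _ = (1 - p) * m := by rw [ENNReal.tsum_mul_right, hk, one_mul]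
  have hmle : m ≤ (1 - p) * m := by
    refine iSup_le fun s => ?_
    have : N = ⋃ n, N ∩ {ω | ∃ i, i < n ∧ ω i ∈ G} := by
      ext ω
      simp only [Set.mem_iUnion, Set.mem_inter_iff, exists_and_left]
      refine ⟨fun h => ⟨h, ?_⟩, fun h => h.1⟩
      obtain ⟨i, -, hi⟩ := h.1 0
      exact ⟨i + 1, i, by omega, hi⟩
    rw [this, Monotone.measure_iUnion]
    · exact iSup_le fun n => hD n s
    · rintro a b hab ω ⟨h1, i, hi, hG⟩
      exact ⟨h1, i, by omega, hG⟩
  have hm0 : m = 0 := by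
    by_contra h0
    have hlt : (1 - p) * m < 1 * m :=
      ENNReal.mul_lt_mul_left h0 (ne_top_of_le_ne_top ENNReal.one_ne_top hm1)
        (ENNReal.sub_lt_self ENNReal.one_ne_top one_ne_zero hp)
    rw [one_mul] at hlt
    exact absurd hmle (not_le.2 hlt)
  have hfin := chainMeas_eq_zero_of_shift hk
    (A := fun n => evInfOften (· ∈ G) ∩ {ω | ∀ i, n ≤ i → ω i ∉ H})
    (fun n => ?_) (fun s => ?_) (fun n s ω hω => ⟨fun j => ?_, fun i hi => ?_⟩)
  · have hall : ∀ᵐ ω ∂chainMeas hk s, ∀ n,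
        ω ∉ evInfOften (· ∈ G) ∩ {ω | ∀ i, n ≤ i → ω i ∉ H} := by
      rw [ae_all_iff]
      exact fun n => measure_eq_zero_iff_ae_notMem.1 (hfin n s)
    filter_upwards [hall] with ω hω hωG n
    by_contra! hcon
    exact hω n ⟨hωG, hcon⟩
  · refine (measurableSet_evInfOften _).inter ?_
    simp only [Set.ofPred_forall]
    exact MeasurableSet.iInter fun i => MeasurableSet.iInter fun _ =>
      measurableSet_eval (· ∉ H) i
  · refine measure_mono_null (fun ω hω => ?_) (le_antisymm ((hle s).trans hm0.le) zero_le)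
    exact ⟨hω.1, fun i => hω.2 i (Nat.zero_le _)⟩
  · obtain ⟨i, hi, hG⟩ := hω.1 (j + 1)
    obtain ⟨i, rfl⟩ : ∃ j, i = j + 1 := ⟨i - 1, by omega⟩
    exact ⟨i, by omega, hG⟩
  · exact hω.2 (i + 1) (by omega)

theorem ae_typicalTraj {F : Set S} (hF : F.Finite)
    (hrec : ∀ s, ∀ᵐ ω ∂chainMeas hk s, ω ∈ evInfOften (· ∈ F)) (s : S) :
    ∀ᵐ ω ∂chainMeas hk s, TypicalTraj k F s ω := by
  have hstep : ∀ᵐ ω ∂chainMeas hk s, ∀ a b, 0 < k a b →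
      ω ∈ evInfOften (· = a) → ω ∈ evInfOften (· = b) := by
    rw [ae_all_iff]
    intro a
    rw [ae_all_iff]
    intro b
    by_cases hab : 0 < k a b
    · filter_upwards [ae_infOften_imp hk (G := {a}) (H := {b}) hab.ne'
        (fun s hs => ⟨b, rfl, by rw [Set.mem_singleton_iff.1 hs]⟩) s] with ω hω _
      exact hω
    · exact Filter.Eventually.of_forall fun ω h => absurd h hab
  filter_upwards [chainMeas_start hk s, ae_step_pos hk s, hrec s, hstep] with ω h0 h1 h2 h3
  refine ⟨h0, h1, exists_infOften_eq hF h2, fun a b hab ha => ?_⟩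
  induction hab with
  | refl => exact ha
  | tail _ hbc ih => exact h3 _ _ hbc ih

end Recurrence

/-! ## Message losses -/

section Losses

variable {C M : Type}

@[simp] theorem chansSize_eps [Fintype C] : chansSize (eps C M) = 0 := by
  simp [chansSize, eps]

theorem chansSize_applyOp_le [Fintype C] [DecidableEq C] (op : LcsOp C M) (w : Chans C M) :
    chansSize (applyOp op w) ≤ chansSize w + 1 := by
  have hupd : ∀ c l, l.length ≤ (w c).length + 1 →
      chansSize (Function.update w c l) ≤ chansSize w + 1 := by
    intro c l hl
    unfold chansSize
    rw [← Finset.add_sum_erase _ _ (Finset.mem_univ c),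
      ← Finset.add_sum_erase _ (fun c => (w c).length) (Finset.mem_univ c)]
    have : ∑ x ∈ Finset.univ.erase c, (Function.update w c l x).length =
        ∑ x ∈ Finset.univ.erase c, (w x).length :=
      Finset.sum_congr rfl fun x hx => by rw [Function.update_of_ne (Finset.ne_of_mem_erase hx)]
    rw [this, Function.update_self]
    omega
  cases op with
  | send c m => exact hupd c _ (by simp)
  | recv c m => exact hupd c _ (by simp; omega)
  | internal => exact Nat.le_succ _

variable [DecidableEq M]

@[simp] theorem countEmb_nil (v : List M) : countEmb v [] = 1 := by
  cases v <;> rfl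

@[simp] theorem countEmb_nil_cons (b : M) (w : List M) : countEmb [] (b :: w) = 0 := rfl

theorem countEmb_cons_cons (a b : M) (v w : List M) :
    countEmb (a :: v) (b :: w) = (if a = b then countEmb v w else 0) + countEmb v (b :: w) := rfl

theorem countEmb_ne_zero_iff {v w : List M} : countEmb v w ≠ 0 ↔ w.Sublist v := by
  induction v generalizing w with
  | nil => cases w <;> simp
  | cons a v ih =>
    cases w with
    | nil => simp
    | cons b w =>
      rw [countEmb_cons_cons, List.cons_sublist_cons', ← ih, ← ih]
      by_cases h : a = b
      · subst h
        simp only [if_true, true_and]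
        omega
      · have h' : ¬ b = a := fun e => h e.symm
        simp [h, h']

/-- The weight of the embeddings of `w` in `v`, with `x` for each lost message and `y` for each
kept one. -/
noncomputable def lossWeight (x y : ℝ≥0∞) (v w : List M) : ℝ≥0∞ :=
  x ^ (v.length - w.length) * y ^ w.length * countEmb v w

theorem lossWeight_eq_zero {x y : ℝ≥0∞} {v w : List M} (h : ¬ w.Sublist v) :
    lossWeight x y v w = 0 := by
  have : countEmb v w = 0 := not_not.1 (mt countEmb_ne_zero_iff.1 h)
  simp [lossWeight, this]

theorem tsum_lossWeight (x y : ℝ≥0∞) (v : List M) :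
    ∑' w, lossWeight x y v w = (x + y) ^ v.length := by
  induction v with
  | nil =>
    rw [tsum_eq_single []]
    · simp [lossWeight]
    · intro w hw
      refine lossWeight_eq_zero fun h => hw ?_
      simpa using h
  | cons a v ih =>
    set g : List M → ℝ≥0∞ := fun w =>
      match w with
      | [] => 0
      | b :: w => if a = b then y * lossWeight x y v w else 0 with hg
    have hrec : ∀ w, lossWeight x y (a :: v) w = x * lossWeight x y v w + g w := by
      intro w
      cases w with
      | nil => simp [lossWeight, hg, pow_succ']
      | cons b w =>
        have h2 : x ^ (v.length - w.length) * y ^ (w.length + 1) * (countEmb v (b :: w) : ℝ≥0∞) =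
            x * lossWeight x y v (b :: w) := by
          by_cases hs : (b :: w).Sublist v
          · have hl : w.length + 1 ≤ v.length := hs.length_le
            obtain ⟨d, hd⟩ := Nat.exists_eq_add_of_le hl
            have e1 : v.length - w.length = d + 1 := by omega
            have e2 : v.length - (b :: w).length = d := by simp; omega
            rw [lossWeight, e1, e2, List.length_cons]
            ring
          · rw [lossWeight_eq_zero hs, mul_zero, not_not.1 (mt countEmb_ne_zero_iff.1 hs)]
            simp
        rw [← h2, lossWeight, countEmb_cons_cons]
        simp only [List.length_cons, Nat.add_sub_add_right, hg]
        split_ifs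
        · rw [lossWeight]
          push_cast
          ring
        · push_cast
          ring
    have hgs : ∑' w, g w = y * ∑' w, lossWeight x y v w := by
      rw [← ENNReal.tsum_mul_left, ← Function.Injective.tsum_eq (List.cons_injective (a := a))]
      · simp [hg]
      · intro w hw
        cases w with
        | nil => simp [hg] at hw
        | cons b w =>
          by_cases hab : a = b
          · exact ⟨w, by rw [hab]⟩
          · simp [hg, hab] at hw
    simp_rw [hrec]
    rw [ENNReal.tsum_add, ENNReal.tsum_mul_left, hgs, ih, List.length_cons]
    ring

variable [Fintype C]

theorem plost_mul_pow {τ : ℝ} (h0 : 0 < τ) (h1 : τ < 1) (r : ℝ≥0∞) (v w : Chans C M) :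
    plost τ v w * r ^ chansSize w =
      ∏ c, lossWeight (ENNReal.ofReal τ) (ENNReal.ofReal (1 - τ) * r) (v c) (w c) := by
  have h1' : 0 ≤ 1 - τ := by linarith
  by_cases hs : ∀ c, (w c).Sublist (v c)
  · have hsub : chansSize v - chansSize w = ∑ c, ((v c).length - (w c).length) := by
      unfold chansSize
      rw [Finset.sum_tsub_distrib]
      exact fun c _ => (hs c).length_le
    simp only [lossWeight, Finset.prod_mul_distrib, Finset.prod_pow_eq_pow_sum, ← hsub, mul_pow]
    rw [plost, ENNReal.ofReal_mul (by positivity), ENNReal.ofReal_mul (by positivity),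
      ENNReal.ofReal_pow h0.le, ENNReal.ofReal_pow h1', ENNReal.ofReal_natCast, Nat.cast_prod]
    unfold chansSize
    ring
  · push Not at hs
    obtain ⟨c, hc⟩ := hs
    rw [Finset.prod_eq_zero (Finset.mem_univ c) (lossWeight_eq_zero hc)]
    have : ∏ c, countEmb (v c) (w c) = 0 :=
      Finset.prod_eq_zero (Finset.mem_univ c) (not_not.1 (mt countEmb_ne_zero_iff.1 hc))
    simp [plost, this]

theorem plost_pos_iff {τ : ℝ} (h0 : 0 < τ) (h1 : τ < 1) (v w : Chans C M) :
    0 < plost τ v w ↔ ∀ c, (w c).Sublist (v c) := by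
  have h1' : 0 < 1 - τ := by linarith
  simp only [plost, ENNReal.ofReal_pos]
  rw [mul_pos_iff_of_pos_left (by positivity), Nat.cast_pos, pos_iff_ne_zero,
    Finset.prod_ne_zero_iff]
  simp [countEmb_ne_zero_iff]

theorem plost_eps {τ : ℝ} (h0 : 0 < τ) (v : Chans C M) :
    plost τ v (eps C M) = ENNReal.ofReal τ ^ chansSize v := by
  simp [plost, ENNReal.ofReal_pow h0.le, eps, chansSize]

variable [DecidableEq C]

theorem tsum_prod_lossWeight (x y : ℝ≥0∞) (v : Chans C M) :
    ∑' w : Chans C M, ∏ c, lossWeight x y (v c) (w c) = (x + y) ^ chansSize v := by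
  have hsum : ∀ c, ∑ w ∈ (v c).sublists.toFinset, lossWeight x y (v c) w =
      (x + y) ^ (v c).length := by
    intro c
    rw [← tsum_lossWeight, tsum_eq_sum]
    intro w hw
    exact lossWeight_eq_zero fun h => hw (by simpa using h)
  rw [tsum_eq_sum (s := Fintype.piFinset fun c => (v c).sublists.toFinset),
    ← Finset.prod_univ_sum, Finset.prod_congr rfl fun c _ => hsum c, Finset.prod_pow_eq_pow_sum]
  · rfl
  · intro w hw
    have : ∃ c, w c ∉ (v c).sublists.toFinset := by simpa [Fintype.mem_piFinset] using hw
    obtain ⟨c, hc⟩ := this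
    exact Finset.prod_eq_zero (Finset.mem_univ c)
      (lossWeight_eq_zero fun h => hc (by simpa using h))

theorem tsum_plost_mul_pow {τ : ℝ} (h0 : 0 < τ) (h1 : τ < 1) (r : ℝ≥0∞) (v : Chans C M) :
    ∑' w, plost τ v w * r ^ chansSize w =
      (ENNReal.ofReal τ + ENNReal.ofReal (1 - τ) * r) ^ chansSize v := by
  simp_rw [plost_mul_pow h0 h1, tsum_prod_lossWeight]

theorem tsum_plost {τ : ℝ} (h0 : 0 < τ) (h1 : τ < 1) (v : Chans C M) :
    ∑' w, plost τ v w = 1 := by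
  have := tsum_plost_mul_pow h0 h1 1 v
  rw [mul_one, ← ENNReal.ofReal_add h0.le (by linarith)] at this
  simpa using this

end Losses

section Schedulers

open MeasureTheory

/-- The states, made of a configuration and a mode, with empty channels. -/
def emptyStates (Q C M Mode : Type) : Set (Conf Q C M × Mode) := {a | a.1.2 = eps C M}

theorem emptyStates_finite (Q C M Mode : Type) [Finite Q] [Finite Mode] :
    (emptyStates Q C M Mode).Finite := by
  refine (Set.finite_range fun p : Q × Mode =>
    (((p.1, eps C M), p.2) : Conf Q C M × Mode)).subset ?_
  rintro ⟨⟨z, w⟩, u⟩ rfl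
  exact ⟨(z, u), rfl⟩

variable {Q C M : Type} [Fintype C] [DecidableEq C] [DecidableEq M] {N : NPLCS Q C M}

theorem stepProb_pos_iff (s : Conf Q C M) (δ : LcsRule Q C M) (t : Conf Q C M) :
    0 < N.stepProb s δ t ↔ N.L.StepVia s δ t := by
  unfold NPLCS.stepProb LCS.StepVia
  split_ifs with h
  · rw [plost_pos_iff N.τ_pos N.τ_lt_one]
    tauto
  · simp only [lt_irrefl, false_iff]
    tauto

theorem tsum_kernel_mul (fm : FMScheduler N) (a : Conf Q C M × fm.Mode)
    (g : Conf Q C M × fm.Mode → ℝ≥0∞) :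
    ∑' b, fm.kernel a b * g b =
      ∑' w, plost N.τ (applyOp (fm.D a.2 a.1).op a.1.2) w *
        g (((fm.D a.2 a.1).dst, w), fm.upd a.2 a.1) := by
  have hinj : Function.Injective fun w : Chans C M =>
      ((((fm.D a.2 a.1).dst, w), fm.upd a.2 a.1) : Conf Q C M × fm.Mode) := by
    intro w w' h
    simpa using h
  rw [← hinj.tsum_eq]
  · refine tsum_congr fun w => ?_
    simp [FMScheduler.kernel, NPLCS.stepProb, fm.D_mem, fm.D_enabled]
  · rintro ⟨⟨z, w⟩, u⟩ hb
    have hk : fm.kernel a ((z, w), u) ≠ 0 := left_ne_zero_of_mul hb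
    by_cases hu : u = fm.upd a.2 a.1
    · by_cases hz : z = (fm.D a.2 a.1).dst
      · exact ⟨w, by simp [hu, hz]⟩
      · simp [FMScheduler.kernel, NPLCS.stepProb, hz] at hk
    · simp [FMScheduler.kernel, hu] at hk

theorem tsum_kernel (fm : FMScheduler N) (a : Conf Q C M × fm.Mode) :
    ∑' b, fm.kernel a b = 1 := by
  have := tsum_kernel_mul fm a fun _ => 1
  simpa [tsum_plost N.τ_pos N.τ_lt_one] using this

theorem exists_drift_bound {τ : ℝ} (h0 : 0 < τ) (h1 : τ < 1) : ∃ K : ℕ, ∀ n, K ≤ n →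
    (ENNReal.ofReal τ + ENNReal.ofReal (1 - τ) * 2) ^ (n + 1) ≤ 2⁻¹ * (2 : ℝ≥0∞) ^ n := by
  have hlim : Filter.Tendsto (fun n : ℕ => (2 - τ) * ((2 - τ) / 2) ^ n) Filter.atTop
      (nhds ((2 - τ) * 0)) :=
    (tendsto_pow_atTop_nhds_zero_of_lt_one (by linarith) (by linarith)).const_mul _
  rw [mul_zero] at hlim
  obtain ⟨K, hK⟩ := Filter.eventually_atTop.1
    (hlim.eventually_le_const (show (0 : ℝ) < 2⁻¹ by norm_num))
  refine ⟨K, fun n hn => ?_⟩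
  have hbase : ENNReal.ofReal τ + ENNReal.ofReal (1 - τ) * 2 = ENNReal.ofReal (2 - τ) := by
    rw [show (2 : ℝ≥0∞) = ENNReal.ofReal 2 by simp, ← ENNReal.ofReal_mul (by linarith),
      ← ENNReal.ofReal_add h0.le (by linarith)]
    congr 1
    ring
  have hright : 2⁻¹ * (2 : ℝ≥0∞) ^ n = ENNReal.ofReal (2⁻¹ * 2 ^ n) := by
    rw [ENNReal.ofReal_mul (by norm_num), ENNReal.ofReal_inv_of_pos (by norm_num),
      ENNReal.ofReal_pow (by norm_num)]
    simp
  rw [hbase, hright, ← ENNReal.ofReal_pow (by linarith)]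
  refine ENNReal.ofReal_le_ofReal ?_
  have h := mul_le_mul_of_nonneg_right (hK n hn) (show (0 : ℝ) ≤ 2 ^ n by positivity)
  rw [div_pow] at h
  calc (2 - τ) ^ (n + 1) = (2 - τ) * ((2 - τ) ^ n / 2 ^ n) * 2 ^ n := by
        field_simp
        ring
    _ ≤ _ := h

instance : MeasurableSpace (Conf Q C M) := ⊤
instance : DiscreteMeasurableSpace (Conf Q C M) := ⟨fun _ => trivial⟩
instance : MeasurableSpace (List (Conf Q C M)) := ⊤
instance : DiscreteMeasurableSpace (List (Conf Q C M)) := ⟨fun _ => trivial⟩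
instance (fm : FMScheduler N) : MeasurableSpace fm.Mode := ⊤
instance (fm : FMScheduler N) : DiscreteMeasurableSpace fm.Mode := ⟨fun _ => trivial⟩
instance (fm : FMScheduler N) : Finite fm.Mode := @Finite.of_fintype _ fm.modeFin

variable [Fintype Q] [Fintype M]

/-- The configurations with empty channels are a recurrent attractor. -/
theorem ae_infOften_emptyStates (fm : FMScheduler N) (a : Conf Q C M × fm.Mode) :
    ∀ᵐ ω ∂chainMeas (tsum_kernel fm) a, ω ∈ evInfOften (· ∈ emptyStates Q C M fm.Mode) := by
  obtain ⟨K, hK⟩ := exists_drift_bound N.τ_pos N.τ_lt_one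
  set G : Set (Conf Q C M × fm.Mode) := {a | chansSize a.1.2 ≤ K} with hG
  have hbase : (1 : ℝ≥0∞) ≤ ENNReal.ofReal N.τ + ENNReal.ofReal (1 - N.τ) * 2 := by
    calc (1 : ℝ≥0∞) = ENNReal.ofReal N.τ + ENNReal.ofReal (1 - N.τ) * 1 := by
          rw [mul_one, ← ENNReal.ofReal_add N.τ_pos.le (by linarith [N.τ_lt_one])]
          simp
      _ ≤ _ := by gcongr; norm_num
  have hhit : ∀ s, chainMeas (tsum_kernel fm) s (evAlways (· ∉ G)) = 0 := by
    refine chainMeas_avoid_eq_zero (tsum_kernel fm) (V := fun a => 2 ^ chansSize a.1.2)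
      (β := 2⁻¹) (ENNReal.inv_lt_one.2 (by norm_num)) (fun s => by finiteness)
      (fun s _ => one_le_pow₀ (by norm_num)) fun s hs => ?_
    rw [tsum_kernel_mul fm s fun a => 2 ^ chansSize a.1.2]
    rw [tsum_plost_mul_pow N.τ_pos N.τ_lt_one]
    refine (pow_le_pow_right₀ hbase (chansSize_applyOp_le _ _)).trans (hK _ ?_)
    exact (not_le.1 hs).le
  have hp : ENNReal.ofReal N.τ ^ (K + 1) ≠ 0 := pow_ne_zero _ (by simpa using N.τ_pos)
  have hmove : ∀ s ∈ G, ∃ t ∈ emptyStates Q C M fm.Mode,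
      ENNReal.ofReal N.τ ^ (K + 1) ≤ fm.kernel s t := by
    intro s hs
    refine ⟨(((fm.D s.2 s.1).dst, eps C M), fm.upd s.2 s.1), rfl, ?_⟩
    have : fm.kernel s (((fm.D s.2 s.1).dst, eps C M), fm.upd s.2 s.1) =
        ENNReal.ofReal N.τ ^ chansSize (applyOp (fm.D s.2 s.1).op s.1.2) := by
      rw [← plost_eps N.τ_pos]
      simp [FMScheduler.kernel, NPLCS.stepProb, fm.D_mem, fm.D_enabled]
    rw [this]
    refine pow_le_pow_of_le_one zero_le (ENNReal.ofReal_le_one.2 N.τ_lt_one.le) ?_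
    exact (chansSize_applyOp_le _ _).trans (Nat.succ_le_succ hs)
  filter_upwards [ae_infOften_of_hit _ hhit a, ae_infOften_imp (tsum_kernel fm) hp hmove a]
    with ω h1 h2
  exact h2 h1

end Schedulers

/-! ## Finite-memory schedulers -/

section FiniteMemory

open MeasureTheory

section Basic

theorem consTraj_mem_evInfOften {S : Type} {P : S → Prop} {s : S} {ω : ℕ → S} :
    consTraj s ω ∈ evInfOften P ↔ ω ∈ evInfOften P := by
  refine ⟨fun h n => ?_, fun h n => ?_⟩
  · obtain ⟨i, hi, hP⟩ := h (n + 1)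
    obtain ⟨i, rfl⟩ : ∃ j, i = j + 1 := ⟨i - 1, by omega⟩
    exact ⟨i, by omega, hP⟩
  · obtain ⟨i, hi, hP⟩ := h n
    exact ⟨i + 1, by omega, hP⟩

variable {Q C M : Type}

theorem measurableSet_streett {n : ℕ} (A B : Fin n → Set Q) :
    MeasurableSet (⋂ i, {ω : ℕ → Conf Q C M | ω ∈ evInfOften (inLoc (A i)) →
      ω ∈ evInfOften (inLoc (B i))}) := by
  refine MeasurableSet.iInter fun i => ?_
  have : {ω : ℕ → Conf Q C M | ω ∈ evInfOften (inLoc (A i)) → ω ∈ evInfOften (inLoc (B i))} =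
      (evInfOften (inLoc (A i)))ᶜ ∪ evInfOften (inLoc (B i)) := by
    ext ω
    simp [imp_iff_not_or]
  rw [this]
  exact (measurableSet_evInfOften _).compl.union (measurableSet_evInfOften _)

theorem measurableSet_infOften_never {n : ℕ} (A B : Fin n → Set Q) (I : Finset (Fin n)) :
    MeasurableSet ((⋂ i ∈ I, evInfOften (inLoc (B i))) ∩
      ⋂ i, ⋂ (_ : i ∉ I), evAlways (fun s : Conf Q C M => s.1 ∉ A i)) :=
  (MeasurableSet.iInter fun _ => MeasurableSet.iInter fun _ => measurableSet_evInfOften _).inter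
    (MeasurableSet.iInter fun _ => MeasurableSet.iInter fun _ => measurableSet_evAlways _)

theorem infOften_never_subset_streett {n : ℕ} (A B : Fin n → Set Q) (I : Finset (Fin n)) :
    ((⋂ i ∈ I, evInfOften (inLoc (B i))) ∩
      ⋂ i, ⋂ (_ : i ∉ I), evAlways (fun s : Conf Q C M => s.1 ∉ A i)) ⊆
    ⋂ i, {ω : ℕ → Conf Q C M | ω ∈ evInfOften (inLoc (A i)) →
      ω ∈ evInfOften (inLoc (B i))} := by
  rintro ω ⟨h1, h2⟩
  refine Set.mem_iInter.2 fun i hA => ?_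
  by_cases hi : i ∈ I
  · exact Set.mem_iInter₂.1 h1 i hi
  · obtain ⟨j, -, hj⟩ := hA 0
    exact absurd hj (Set.mem_iInter₂.1 h2 i hi j)

theorem LCS.exists_enabled_rule (L : LCS Q C M) (s : Conf Q C M) :
    ∃ δ ∈ L.rules, δ.EnabledIn s := by
  obtain ⟨δ, hδ, hsrc, hop⟩ := L.noDeadlock s.1
  refine ⟨δ, hδ, hsrc, ?_⟩
  cases h : δ.op <;> simp_all [enabledOp, LcsOp.IsRecv]

variable {N : NPLCS Q C M}

/-- The scheduler induced by finite-memory data. -/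
def FMScheduler.toScheduler (fm : FMScheduler N) : Scheduler N where
  choose h s := fm.D (h.foldl fm.upd fm.init) s
  choose_mem _ _ := fm.D_mem _ _
  choose_enabled _ _ := fm.D_enabled _ _

theorem FMScheduler.toScheduler_finiteMemory (fm : FMScheduler N) :
    fm.toScheduler.FiniteMemory :=
  ⟨fm, fun _ _ => rfl⟩

variable [DecidableEq C]

theorem LCS.reach_eps {L : LCS Q C M} {q : Q} {t : Conf Q C M} (h : L.Reach (q, eps C M) t) :
    L.Reach (q, eps C M) (t.1, eps C M) := by
  rcases Relation.ReflTransGen.cases_tail h with rfl | ⟨s, hs, δ, h1, h2, h3, -⟩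
  · exact Relation.ReflTransGen.refl
  · exact hs.tail ⟨δ, h1, h2, h3, fun c => List.nil_sublist _⟩

variable [Fintype C] [DecidableEq M]

theorem isLumping_kernel (U : Scheduler N) (fm : FMScheduler N)
    (hU : ∀ h s, U.choose h s = fm.D (h.foldl fm.upd fm.init) s) :
    IsLumping U.kernel fm.kernel
      fun p : List (Conf Q C M) × Conf Q C M => (p.2, p.1.foldl fm.upd fm.init) := by
  rintro p ⟨c, u⟩
  rw [tsum_eq_single (p.1 ++ [p.2], c)]
  · simp [Scheduler.kernel, FMScheduler.kernel, hU, eq_comm]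
  · rintro ⟨h, c'⟩ hne
    split_ifs with heq
    · have hc : c' = c := (Prod.mk.inj heq).1
      have hh : h ≠ p.1 ++ [p.2] := fun e => hne (by rw [e, hc])
      simp [Scheduler.kernel, hh]
    · rfl

/-- Fire the rule `δ` from `s` in a first step, then behave as `fm`. -/
noncomputable def FMScheduler.prepend (fm : FMScheduler N) (s : Conf Q C M) (δ : LcsRule Q C M)
    (hδ : δ ∈ N.L.rules) (hs : δ.EnabledIn s) : FMScheduler N where
  Mode := Option fm.Mode
  modeFin := @instFintypeOption _ fm.modeFin
  init := none
  D u c :=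
    match u with
    | none => if c = s then δ else (N.L.exists_enabled_rule c).choose
    | some u => fm.D u c
  upd u c :=
    match u with
    | none => some fm.init
    | some u => some (fm.upd u c)
  D_mem u c := by
    cases u with
    | none =>
      dsimp only
      split_ifs
      · exact hδ
      · exact (N.L.exists_enabled_rule c).choose_spec.1
    | some u => exact fm.D_mem u c
  D_enabled u c := by
    cases u with
    | none =>
      dsimp only
      split_ifs with h
      · exact h ▸ hs
      · exact (N.L.exists_enabled_rule c).choose_spec.2
    | some u => exact fm.D_enabled u c

theorem FMScheduler.isLumping_prepend (fm : FMScheduler N) (s : Conf Q C M)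
    (δ : LcsRule Q C M) (hδ : δ ∈ N.L.rules) (hs : δ.EnabledIn s) :
    IsLumping (T := Conf Q C M × (fm.prepend s δ hδ hs).Mode) fm.kernel
      (fm.prepend s δ hδ hs).kernel fun a => (a.1, some a.2) := by
  rintro a ⟨c, u⟩
  cases u with
  | none =>
    have h : (fm.prepend s δ hδ hs).kernel (a.1, some a.2) (c, none) = 0 :=
      if_neg (fun e : none = some (fm.upd a.2 a.1) => by cases e)
    dsimp only
    rw [h, ENNReal.tsum_eq_zero]
    exact fun t => if_neg fun e => by cases e
  | some u =>
    rw [tsum_eq_single (c, u)]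
    · rw [if_pos rfl]
      by_cases hu : u = fm.upd a.2 a.1
      · exact (if_pos hu).trans (if_pos (congrArg some hu)).symm
      · exact (if_neg hu).trans (if_neg fun e => hu (Option.some.inj e)).symm
    · rintro ⟨c', u'⟩ hne
      exact if_neg fun e => hne (by cases e; rfl)

theorem step_of_kernel_pos {fm : FMScheduler N} {a b : Conf Q C M × fm.Mode}
    (h : 0 < fm.kernel a b) : N.L.Step a.1 b.1 := by
  unfold FMScheduler.kernel at h
  split_ifs at h with hu
  · exact ⟨_, (stepProb_pos_iff _ _ _).1 h⟩
  · exact absurd h (lt_irrefl _)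

theorem reach_of_chainReach {fm : FMScheduler N} {a b : Conf Q C M × fm.Mode}
    (h : chainReach fm.kernel a b) : N.L.Reach a.1 b.1 := by
  induction h with
  | refl => exact Relation.ReflTransGen.refl
  | tail _ h ih => exact ih.tail (step_of_kernel_pos h)

end Basic

variable {Q C M : Type} [Fintype Q] [Fintype C] [DecidableEq C] [Fintype M] [DecidableEq M]
  {N : NPLCS Q C M}

theorem ae_typicalTraj_kernel (fm : FMScheduler N) (a : Conf Q C M × fm.Mode) :
    ∀ᵐ ω ∂chainMeas (tsum_kernel fm) a,
      TypicalTraj fm.kernel (emptyStates Q C M fm.Mode) a ω :=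
  ae_typicalTraj (tsum_kernel fm) (emptyStates_finite Q C M fm.Mode)
    (ae_infOften_emptyStates fm) a

/-- The probability of an event under a finite-memory scheduler, computed in its finite-memory
Markov chain. -/
theorem Scheduler.Pr_eq_chainMeas (U : Scheduler N) (fm : FMScheduler N)
    (hU : ∀ h s, U.choose h s = fm.D (h.foldl fm.upd fm.init) s) (s : Conf Q C M)
    {E : Set (ℕ → Conf Q C M)} (hE : MeasurableSet E) :
    U.Pr s E = chainMeas (tsum_kernel fm) (s, fm.init) {ω | (fun i => (ω i).1) ∈ E} := by
  have hf := isLumping_kernel U fm hU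
  have hk := hf.tsum_eq_one (tsum_kernel fm)
  have h1 : MeasurableSet {ω : ℕ → List (Conf Q C M) × Conf Q C M | (fun i => (ω i).2) ∈ E} :=
    measurable_comp_traj Prod.snd hE
  have h2 : MeasurableSet {ω : ℕ → Conf Q C M × fm.Mode | (fun i => (ω i).1) ∈ E} :=
    measurable_comp_traj Prod.fst hE
  rw [← chainPr_eq_chainMeas (tsum_kernel fm) _ h2, Scheduler.Pr, chainPr_eq_chainMeas hk _ h1]
  exact (chainPr_lump hk (tsum_kernel fm) hf ([], s) h2).symm

/-- Positive probability of an event that is stable under prepending states propagates backwards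
along reachability. -/
theorem exists_pos_of_reach {E : Set (ℕ → Conf Q C M)} (hE : MeasurableSet E)
    (hcons : ∀ s, ∀ ω ∈ E, consTraj s ω ∈ E) {s t : Conf Q C M} (hst : N.L.Reach s t)
    (ht : ∃ fm : FMScheduler N,
      0 < chainMeas (tsum_kernel fm) (t, fm.init) {ω | (fun i => (ω i).1) ∈ E}) :
    ∃ fm : FMScheduler N,
      0 < chainMeas (tsum_kernel fm) (s, fm.init) {ω | (fun i => (ω i).1) ∈ E} := by
  induction hst using Relation.ReflTransGen.head_induction_on with
  | refl => exact ht
  | @head s x hsx _ ih =>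
    obtain ⟨fm, hfm⟩ := ih
    obtain ⟨δ, hδ⟩ := hsx
    set fm' := fm.prepend s δ hδ.1 hδ.2.1
    refine ⟨fm', ?_⟩
    have hE' : MeasurableSet {ω : ℕ → Conf Q C M × fm'.Mode | (fun i => (ω i).1) ∈ E} :=
      measurable_comp_traj Prod.fst hE
    have hlump := chainPr_lump (tsum_kernel fm) (tsum_kernel fm')
      (fm.isLumping_prepend s δ hδ.1 hδ.2.1) (x, fm.init) hE'
    rw [chainPr_eq_chainMeas (tsum_kernel fm') _ hE'] at hlump
    rw [chainMeas_step _ _ hE']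
    have hk : 0 < fm'.kernel (s, fm'.init) (x, some fm.init) := by
      have : fm'.kernel (s, fm'.init) (x, some fm.init) = N.stepProb s δ x := by
        refine (if_pos rfl).trans ?_
        change N.stepProb s (if s = s then δ else _) x = _
        rw [if_pos rfl]
      rw [this]
      exact (stepProb_pos_iff s δ x).2 hδ
    refine lt_of_lt_of_le (ENNReal.mul_pos hk.ne' ?_) (ENNReal.le_tsum (x, some fm.init))
    refine (lt_of_lt_of_le hfm (hlump.symm.le.trans (measure_mono fun ω hω => ?_))).ne'
    have : (fun i => (consTraj (s, fm'.init) ω i).1) = consTraj s fun i => (ω i).1 := by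
      funext i
      cases i <;> rfl
    change (fun i => (consTraj (s, fm'.init) ω i).1) ∈ E
    rw [this]
    exact hcons s _ hω

/-- A state with empty channels that is visited infinitely often along a typical trajectory
satisfying the Streett condition almost surely satisfies the condition given by the reachable
sets `B i`. -/
theorem chainMeas_infOften_never {n : ℕ} {A B : Fin n → Set Q} {fm : FMScheduler N}
    {s a : Conf Q C M × fm.Mode} {ω : ℕ → Conf Q C M × fm.Mode}
    (hω : TypicalTraj fm.kernel (emptyStates Q C M fm.Mode) s ω)
    (hS : ∀ i, ω ∈ evInfOften (fun x => x.1.1 ∈ A i) → ω ∈ evInfOften (fun x => x.1.1 ∈ B i))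
    (ha : ω ∈ evInfOften (· = a)) (I : Finset (Fin n))
    (hI : ∀ i, i ∈ I ↔ ∃ b, chainReach fm.kernel a b ∧ b.1.1 ∈ B i) :
    chainMeas (tsum_kernel fm) a {ξ | (fun i => (ξ i).1) ∈
      (⋂ i ∈ I, evInfOften (inLoc (B i))) ∩
        ⋂ i, ⋂ (_ : i ∉ I), evAlways (fun s : Conf Q C M => s.1 ∉ A i)} = 1 := by
  have hafter : ∀ m, ∃ j, m ≤ j ∧ ω j = a := ha
  have hnever : ∀ i ∉ I, ∀ b, chainReach fm.kernel a b → b.1.1 ∉ A i := by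
    intro i hi b hab hb
    have hbi : ω ∈ evInfOften (· = b) := hω.closed a b hab ha
    have hAi : ω ∈ evInfOften (fun x => x.1.1 ∈ A i) := fun m => by
      obtain ⟨j, hj, e⟩ := hbi m
      exact ⟨j, hj, by rw [e]; exact hb⟩
    obtain ⟨j, -, hj⟩ := hafter 0
    obtain ⟨l, hl, hBl⟩ := hS i hAi j
    exact hi ((hI i).2 ⟨ω l, hj ▸ hω.reach hl, hBl⟩)
  have hback : ∀ b, chainReach fm.kernel a b → chainReach fm.kernel b a := by
    intro b hab
    obtain ⟨j, -, hj⟩ := hω.closed a b hab ha 0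
    obtain ⟨l, hl, hal⟩ := hafter j
    have := hω.reach hl
    rwa [hj, hal] at this
  refine (mem_ae_iff_prob_eq_one
    (measurable_comp_traj Prod.fst (measurableSet_infOften_never A B I))).1 ?_
  filter_upwards [ae_typicalTraj_kernel fm a] with ξ hξ
  have hreach : ∀ j, chainReach fm.kernel a (ξ j) := fun j => by
    have := hξ.reach (Nat.zero_le j)
    rwa [hξ.start] at this
  refine ⟨Set.mem_iInter₂.2 fun i hi m => ?_, Set.mem_iInter₂.2 fun i hi j => ?_⟩
  · obtain ⟨b, hab, hb⟩ := (hI i).1 hi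
    obtain ⟨f, -, hf⟩ := hξ.recur
    obtain ⟨l, -, hl⟩ := hf 0
    have hfb : chainReach fm.kernel f b := (hback f (hl ▸ hreach l)).trans hab
    obtain ⟨j, hj, e⟩ := hξ.closed f b hfb hf m
    refine ⟨j, hj, ?_⟩
    change (ξ j).1.1 ∈ B i
    rw [e]
    exact hb
  · exact hnever i hi _ (hreach j)

end FiniteMemory

/-- With `C_I` the set of locations from which some finite-memory scheduler
satisfies `⋀_{i∈I} □◇Bᵢ ∧ ⋀_{i∉I} □¬Aᵢ` almost surely, and `C = ⋃_I C_I`: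
`C` is reachable from `(q,ε)` iff some finite-memory scheduler satisfies the
Streett condition `⋀ᵢ (□◇Aᵢ ⇒ □◇Bᵢ)` with positive probability. -/
theorem statement16 {Q C M : Type} [Fintype Q] [Fintype C] [DecidableEq C]
    [Fintype M] [DecidableEq M] (N : NPLCS Q C M) (q : Q) (n : ℕ)
    (A B : Fin n → Set Q) :
    (∃ t, N.L.Reach (q, eps C M) t ∧
        t.1 ∈ ⋃ I : Finset (Fin n),
          {z : Q | ∃ W : Scheduler N, W.FiniteMemory ∧
            W.Pr (z, eps C M)
              ((⋂ i ∈ I, evInfOften (inLoc (B i))) ∩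
                ⋂ i, ⋂ (_ : i ∉ I),
                  evAlways (fun s : Conf Q C M => s.1 ∉ A i)) = 1})
    ↔ (∃ U : Scheduler N, U.FiniteMemory ∧
        0 < U.Pr (q, eps C M)
          (⋂ i, {ω | ω ∈ evInfOften (inLoc (A i)) →
                      ω ∈ evInfOften (inLoc (B i))})) := by

  constructor
  · rintro ⟨t, hreach, ht⟩
    obtain ⟨I, W, ⟨fm, hfm⟩, hW⟩ := Set.mem_iUnion.1 ht
    rw [W.Pr_eq_chainMeas fm hfm _ (measurableSet_infOften_never A B I)] at hW
    have hpos : 0 < chainMeas (tsum_kernel fm) ((t.1, eps C M), fm.init)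
        {ω | (fun i => (ω i).1) ∈ ⋂ i, {ω : ℕ → Conf Q C M |
          ω ∈ evInfOften (inLoc (A i)) → ω ∈ evInfOften (inLoc (B i))}} := by
      refine lt_of_lt_of_le zero_lt_one (hW.symm.le.trans (MeasureTheory.measure_mono ?_))
      exact fun ω hω => infOften_never_subset_streett A B I hω
    obtain ⟨fm', hfm'⟩ := exists_pos_of_reach (measurableSet_streett A B) (fun s ω hω => by
      refine Set.mem_iInter.2 fun i => ?_
      have := Set.mem_iInter.1 hω i
      simpa only [Set.mem_ofPred_eq, consTraj_mem_evInfOften] using this)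
      (LCS.reach_eps hreach) ⟨fm, hpos⟩
    refine ⟨fm'.toScheduler, fm'.toScheduler_finiteMemory, ?_⟩
    rw [fm'.toScheduler.Pr_eq_chainMeas fm' (fun _ _ => rfl) _ (measurableSet_streett A B)]
    exact hfm'
  · rintro ⟨U, ⟨fm, hfm⟩, hU⟩
    rw [U.Pr_eq_chainMeas fm hfm _ (measurableSet_streett A B)] at hU
    obtain ⟨ω, hωS, hω⟩ := (MeasureTheory.frequently_ae_mem_iff.2 hU.ne').and_eventually
      (ae_typicalTraj_kernel fm ((q, eps C M), fm.init)) |>.exists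
    obtain ⟨⟨⟨z, w⟩, u⟩, ha, haω⟩ := hω.recur
    obtain rfl : w = eps C M := ha
    obtain ⟨j, -, hj⟩ := haω 0
    have hqz := reach_of_chainReach (hω.reach (Nat.zero_le j))
    rw [hω.start, hj] at hqz
    set I : Finset (Fin n) := Finset.univ.filter fun i =>
      ∃ b, chainReach fm.kernel ((z, eps C M), u) b ∧ b.1.1 ∈ B i
    refine ⟨_, hqz, Set.mem_iUnion.2 ⟨I, ?_⟩⟩
    set fm' : FMScheduler N := { fm with init := u }
    refine ⟨fm'.toScheduler, fm'.toScheduler_finiteMemory, ?_⟩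
    rw [fm'.toScheduler.Pr_eq_chainMeas fm' (fun _ _ => rfl) _
      (measurableSet_infOften_never A B I)]
    exact chainMeas_infOften_never (fm := fm') hω (fun i => Set.mem_iInter.1 hωS i) haω I
      (fun i => by simp [I, fm']; rfl)

end NPLCSmodel
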